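/- Suppose m ≥ 2, and let f be an automorphism of P_m. Let I, J, I', J' be pairwise distinct 2m-element subsets of {1,…,n} with I △ J = I' △ J', and assume that either n ≥ 3m + 1, or n = 3m and |I △ J| = 2. Then f(I) △ f(J) = f(I') △ f(J'). -/

import Mathlib

open scoped symmDiff

/-- A bijection of the set of `2m`-element subsets of `{1,…,n}` preserving collinearity
in both directions and compatible with the line structure: an automorphism of `P_m`. -/
def IsAutPm (n m : ℕ) (f : Finset (Fin n) → Finset (Fin n)) : Prop :=
  Set.BijOn f {I : Finset (Fin n) | I.card = 2 * m}
      {I : Finset (Fin n) | I.card = 2 * m} ∧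
  (∀ I J : Finset (Fin n), I.card = 2 * m → J.card = 2 * m →
    ((I ∩ J).card = m ↔ (f I ∩ f J).card = m)) ∧
  (∀ I J : Finset (Fin n), I.card = 2 * m → J.card = 2 * m → (I ∩ J).card = m →
    f (I ∆ J) = f I ∆ f J)

section Auxiliary

variable {α β : Type*} [DecidableEq α]

lemma Finset.card_symmDiff_add_two_mul_card_inter (A B : Finset α) :
    (A ∆ B).card + 2 * (A ∩ B).card = A.card + B.card := by
  have h1 : (A ∆ B).card = (A \ B).card + (B \ A).card :=
    Finset.card_union_of_disjoint disjoint_sdiff_sdiff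
  have h2 := Finset.card_sdiff_add_card_inter A B
  have h3 := Finset.card_sdiff_add_card_inter B A
  rw [Finset.inter_comm B A] at h3
  omega

lemma symmDiff_eq_symmDiff_of_swap {p q r s : Finset α} (h : p ∆ q = r ∆ s) :
    p ∆ r = q ∆ s := by
  ext a
  have := Finset.ext_iff.1 h a
  simp only [Finset.mem_symmDiff] at this ⊢
  tauto

/-- A function on finsets that is invariant under the exchange of single elements of `U`
takes the same value on two equinumerous finsets that agree outside `U`. -/
lemma eq_of_swap_invariant (U : Set α) (Q : Finset α → Prop) (G : Finset α → β)
    (hQ : ∀ I x y, Q I → x ∈ I → y ∉ I → x ∈ U → y ∈ U →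
      Q (insert y (I.erase x)) ∧ G (insert y (I.erase x)) = G I)
    (I I' : Finset α) (hI : Q I) (hcard : I.card = I'.card)
    (hU : ∀ x, x ∉ U → (x ∈ I ↔ x ∈ I')) : G I = G I' := by
  induction hd : (I \ I').card generalizing I with
  | zero =>
    have hsub : I ⊆ I' := by simpa [Finset.sdiff_eq_empty_iff_subset] using hd
    rw [Finset.eq_of_subset_of_card_le hsub hcard.ge]
  | succ d ih =>
    have hd' : (I' \ I).card = d + 1 := by
      have := Finset.card_sdiff_add_card_inter I I'
      have h2 := Finset.card_sdiff_add_card_inter I' I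
      rw [Finset.inter_comm] at h2
      omega
    obtain ⟨x, hx⟩ : (I \ I').Nonempty := Finset.card_pos.1 (by omega)
    obtain ⟨y, hy⟩ : (I' \ I).Nonempty := Finset.card_pos.1 (by omega)
    rw [Finset.mem_sdiff] at hx hy
    have hxU : x ∈ U := by
      by_contra h
      exact hx.2 ((hU x h).1 hx.1)
    have hyU : y ∈ U := by
      by_contra h
      exact hy.2 ((hU y h).2 hy.1)
    obtain ⟨hQ', hG⟩ := hQ I x y hI hx.1 hy.2 hxU hyU
    rw [← hG]
    refine ih _ hQ' ?_ ?_ ?_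
    · rw [Finset.card_insert_of_notMem (by simp [hy.2]), Finset.card_erase_of_mem hx.1, ← hcard]
      have := Finset.card_pos.2 ⟨x, hx.1⟩
      omega
    · intro z hz
      have hzx : z ≠ x := fun h => hz (h ▸ hxU)
      have hzy : z ≠ y := fun h => hz (h ▸ hyU)
      simp [hzx, hzy, hU z hz]
    · have : insert y (I.erase x) \ I' = (I \ I').erase x := by
        ext z
        by_cases hzy : z = y
        · subst hzy
          simp [hy.1]
        · simp [hzy, and_assoc]
      rw [this, Finset.card_erase_of_mem (by simp [hx]), hd]
      rfl

lemma card_insert_erase_inter {I X : Finset α} {x y : α} (hx : x ∈ I) (hy : y ∉ I)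
    (h : x ∈ X ↔ y ∈ X) : (insert y (I.erase x) ∩ X).card = (I ∩ X).card := by
  by_cases hxX : x ∈ X
  · have hyX := h.1 hxX
    rw [Finset.insert_inter_of_mem hyX, Finset.erase_inter,
      Finset.card_insert_of_notMem (by simp [hy]),
      Finset.card_erase_of_mem (by simp [hx, hxX])]
    have : 0 < (I ∩ X).card := Finset.card_pos.2 ⟨x, by simp [hx, hxX]⟩
    omega
  · have hyX : y ∉ X := fun hyX => hxX (h.2 hyX)
    rw [Finset.insert_inter_of_notMem hyX, Finset.erase_inter,
      Finset.erase_eq_of_notMem (by simp [hxX])]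

/-- A finset containing `P` with prescribed numbers of elements in the four cells of the
partition of the ground set generated by `I` and `D`. -/
lemma exists_superset_card_cells [Fintype α] (I D P : Finset α) (a b c d : ℕ)
    (ha : (P ∩ (I ∩ D)).card ≤ a) (ha' : a ≤ (I ∩ D).card)
    (hb : (P ∩ (D \ I)).card ≤ b) (hb' : b ≤ (D \ I).card)
    (hc : (P ∩ (I \ D)).card ≤ c) (hc' : c ≤ (I \ D).card)
    (hd : (P ∩ (I ∪ D)ᶜ).card ≤ d) (hd' : d ≤ (I ∪ D)ᶜ.card) :
    ∃ X, P ⊆ X ∧ X.card = a + b + c + d ∧ (X ∩ D).card = a + b ∧ (I ∩ X).card = a + c := by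
  obtain ⟨A, hPA, hA, rfl⟩ := Finset.exists_subsuperset_card_eq Finset.inter_subset_right ha ha'
  obtain ⟨B, hPB, hB, rfl⟩ := Finset.exists_subsuperset_card_eq Finset.inter_subset_right hb hb'
  obtain ⟨C, hPC, hC, rfl⟩ := Finset.exists_subsuperset_card_eq Finset.inter_subset_right hc hc'
  obtain ⟨E, hPE, hE, rfl⟩ := Finset.exists_subsuperset_card_eq Finset.inter_subset_right hd hd'
  have hAB : Disjoint A B := by
    rw [Finset.disjoint_left]; intro z h1 h2; have := hA h1; have := hB h2; simp_all
  have hAC : Disjoint A C := by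
    rw [Finset.disjoint_left]; intro z h1 h2; have := hA h1; have := hC h2; simp_all
  have hABC : Disjoint (A ∪ B) C := by
    rw [Finset.disjoint_union_left]; refine ⟨hAC, ?_⟩
    rw [Finset.disjoint_left]; intro z h1 h2; have := hB h1; have := hC h2; simp_all
  have hABCE : Disjoint (A ∪ B ∪ C) E := by
    rw [Finset.disjoint_left]; intro z h1 h2
    have := hE h2
    simp only [Finset.mem_union] at h1
    rcases h1 with (h | h) | h
    · have := hA h; simp_all
    · have := hB h; simp_all
    · have := hC h; simp_all
  refine ⟨A ∪ B ∪ C ∪ E, ?_, ?_, ?_, ?_⟩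
  · intro z hz
    by_cases hzI : z ∈ I <;> by_cases hzD : z ∈ D
    · have := @hPA z (by simp [*]); simp [*]
    · have := @hPC z (by simp [*]); simp [*]
    · have := @hPB z (by simp [*]); simp [*]
    · have := @hPE z (by simp [*]); simp [*]
  · rw [Finset.card_union_of_disjoint hABCE, Finset.card_union_of_disjoint hABC,
      Finset.card_union_of_disjoint hAB]
  · rw [← Finset.card_union_of_disjoint hAB]
    congr 1
    ext z
    have h1 := @hA z
    have h2 := @hB z
    have h3 := @hC z
    have h4 := @hE z
    simp only [Finset.mem_inter, Finset.mem_union, Finset.mem_sdiff, Finset.mem_compl]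
      at h1 h2 h3 h4 ⊢
    tauto
  · rw [← Finset.card_union_of_disjoint hAC]
    congr 1
    ext z
    have h1 := @hA z
    have h2 := @hB z
    have h3 := @hC z
    have h4 := @hE z
    simp only [Finset.mem_inter, Finset.mem_union, Finset.mem_sdiff, Finset.mem_compl]
      at h1 h2 h3 h4 ⊢
    tauto

end Auxiliary

section Translation

variable {n m k : ℕ} {f : Finset (Fin n) → Finset (Fin n)} {D I X : Finset (Fin n)}

/-- The image of a pair of points with difference `D` has the same difference as the image of
its translate by a common neighbour. -/
lemma IsAutPm.symmDiff_eq_of_card_inter (hf : IsAutPm n m f) (hD : D.card = 2 * k)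
    (hI : I.card = 2 * m) (hID : (I ∩ D).card = k) (hX : X.card = 2 * m)
    (hXD : (X ∩ D).card = k) (hIX : (I ∩ X).card = m) :
    f I ∆ f (I ∆ D) = f X ∆ f (X ∆ D) := by
  have e : (I ∆ D) ∆ (X ∆ D) = I ∆ X := by
    rw [symmDiff_symmDiff_symmDiff_comm, symmDiff_self, symmDiff_bot]
  have c1 := Finset.card_symmDiff_add_two_mul_card_inter I D
  have c2 := Finset.card_symmDiff_add_two_mul_card_inter X D
  have c3 := Finset.card_symmDiff_add_two_mul_card_inter I X
  have c4 := Finset.card_symmDiff_add_two_mul_card_inter (I ∆ D) (X ∆ D)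
  rw [e] at c4
  apply symmDiff_eq_symmDiff_of_swap
  rw [← hf.2.2 I X hI hX hIX,
    ← hf.2.2 (I ∆ D) (X ∆ D) (by omega) (by omega) (by omega), e]

/-- Cardinalities of the cells cut out by `I` and `D`. -/
lemma card_cells (hD : D.card = 2 * k) (hI : I.card = 2 * m) (hID : (I ∩ D).card = k) :
    (D \ I).card = k ∧ (I \ D).card + k = 2 * m ∧ (I ∪ D)ᶜ.card + (2 * m + k) = n := by
  have h1 := Finset.card_sdiff_add_card_inter I D
  have h2 := Finset.card_sdiff_add_card_inter D I
  have h3 := Finset.card_union_add_card_inter I D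
  have h4 := Finset.card_add_card_compl (I ∪ D)
  rw [Finset.inter_comm] at h2
  rw [Fintype.card_fin] at h4
  omega

lemma IsAutPm.symmDiff_swap_of_mem (hf : IsAutPm n m f) (hm : 2 ≤ m)
    (hcase : 3 * m + 1 ≤ n ∨ (n = 3 * m ∧ k = 1)) (hD : D.card = 2 * k)
    (hI : I.card = 2 * m) (hID : (I ∩ D).card = k) {x y : Fin n}
    (hx : x ∈ I) (hy : y ∉ I) (hxD : x ∈ D) (hyD : y ∈ D) :
    f (insert y (I.erase x)) ∆ f (insert y (I.erase x) ∆ D) = f I ∆ f (I ∆ D) := by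
  have hxy : x ≠ y := fun h => hy (h ▸ hx)
  obtain ⟨h1, h2, h3⟩ := card_cells hD hI hID
  have hk0 : 0 < k := hID ▸ Finset.card_pos.2 ⟨x, by simp [hx, hxD]⟩
  have cI : (insert y (I.erase x)).card = 2 * m := by
    rw [Finset.card_insert_of_notMem (by simp [hy]), Finset.card_erase_of_mem hx, hI]
    omega
  rcases Nat.lt_or_ge 1 k with hk | hk
  · obtain ⟨s, hs⟩ : ∃ s, s = max (m + 1 - k) (4 * m - n) := ⟨_, rfl⟩
    obtain ⟨X, hPX, hX, hXD, hIX⟩ := exists_superset_card_cells I D {x, y}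
      (m - s) (k - (m - s)) s (2 * m - k - s)
      (by
        have : ({x, y} : Finset (Fin n)) ∩ (I ∩ D) = {x} := by
          ext z; simp only [Finset.mem_inter, Finset.mem_insert, Finset.mem_singleton]; grind
        rw [this, Finset.card_singleton]; omega)
      (by omega)
      (by
        have : ({x, y} : Finset (Fin n)) ∩ (D \ I) = {y} := by
          ext z; simp only [Finset.mem_inter, Finset.mem_insert, Finset.mem_singleton,
            Finset.mem_sdiff]; grind
        rw [this, Finset.card_singleton]; omega)
      (by omega)
      (by
        have : ({x, y} : Finset (Fin n)) ∩ (I \ D) = ∅ := by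
          ext z; simp only [Finset.mem_inter, Finset.mem_insert, Finset.mem_singleton,
            Finset.mem_sdiff, Finset.notMem_empty]; grind
        rw [this, Finset.card_empty]; omega)
      (by omega)
      (by
        have : ({x, y} : Finset (Fin n)) ∩ (I ∪ D)ᶜ = ∅ := by
          ext z; simp only [Finset.mem_inter, Finset.mem_insert, Finset.mem_singleton,
            Finset.mem_union, Finset.mem_compl, Finset.notMem_empty]; grind
        rw [this, Finset.card_empty]; omega)
      (by omega)
    have hxX : x ∈ X := hPX (by simp)
    have hyX : y ∈ X := hPX (by simp)
    rw [hf.symmDiff_eq_of_card_inter hD hI hID (X := X) (by omega) (by omega) (by omega)]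
    refine hf.symmDiff_eq_of_card_inter hD cI ?_ (by omega) (by omega) ?_
    · rw [card_insert_erase_inter hx hy (by simp [hxD, hyD]), hID]
    · rw [card_insert_erase_inter hx hy (by simp [hxX, hyX])]
      omega
  · have hDxy : D = {x, y} := by
      symm
      apply Finset.eq_of_subset_of_card_le
      · intro z hz
        simp only [Finset.mem_insert, Finset.mem_singleton] at hz
        rcases hz with rfl | rfl <;> assumption
      · rw [Finset.card_pair hxy]; omega
    have e : insert y (I.erase x) = I ∆ D := by
      ext z
      simp only [hDxy, Finset.mem_symmDiff, Finset.mem_insert, Finset.mem_singleton,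
        Finset.mem_erase]
      grind
    rw [e, symmDiff_assoc, symmDiff_self, symmDiff_bot, symmDiff_comm]

lemma IsAutPm.symmDiff_swap_of_notMem (hf : IsAutPm n m f) (hm : 2 ≤ m) (hn : 3 * m ≤ n)
    (hk : k + 2 ≤ 2 * m) (hD : D.card = 2 * k)
    (hI : I.card = 2 * m) (hID : (I ∩ D).card = k) {x y : Fin n}
    (hx : x ∈ I) (hy : y ∉ I) (hxD : x ∉ D) (hyD : y ∉ D) :
    f (insert y (I.erase x)) ∆ f (insert y (I.erase x) ∆ D) = f I ∆ f (I ∆ D) := by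
  obtain ⟨h1, h2, h3⟩ := card_cells hD hI hID
  have hN : 0 < (I ∪ D)ᶜ.card := Finset.card_pos.2 ⟨y, by simp [hy, hyD]⟩
  have cI : (insert y (I.erase x)).card = 2 * m := by
    rw [Finset.card_insert_of_notMem (by simp [hy]), Finset.card_erase_of_mem hx, hI]
    omega
  obtain ⟨s, hs⟩ : ∃ s, s = max 1 (max (m - k) (4 * m - n)) := ⟨_, rfl⟩
  obtain ⟨X, hPX, hX, hXD, hIX⟩ := exists_superset_card_cells I D {x, y}
    (m - s) (k - (m - s)) s (2 * m - k - s)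
    (by
      have : ({x, y} : Finset (Fin n)) ∩ (I ∩ D) = ∅ := by
        ext z; simp only [Finset.mem_inter, Finset.mem_insert, Finset.mem_singleton,
          Finset.notMem_empty]; grind
      rw [this, Finset.card_empty]; omega)
    (by omega)
    (by
      have : ({x, y} : Finset (Fin n)) ∩ (D \ I) = ∅ := by
        ext z; simp only [Finset.mem_inter, Finset.mem_insert, Finset.mem_singleton,
          Finset.mem_sdiff, Finset.notMem_empty]; grind
      rw [this, Finset.card_empty]; omega)
    (by omega)
    (by
      have : ({x, y} : Finset (Fin n)) ∩ (I \ D) = {x} := by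
        ext z; simp only [Finset.mem_inter, Finset.mem_insert, Finset.mem_singleton,
          Finset.mem_sdiff]; grind
      rw [this, Finset.card_singleton]; omega)
    (by omega)
    (by
      have : ({x, y} : Finset (Fin n)) ∩ (I ∪ D)ᶜ = {y} := by
        ext z; simp only [Finset.mem_inter, Finset.mem_insert, Finset.mem_singleton,
          Finset.mem_union, Finset.mem_compl]; grind
      rw [this, Finset.card_singleton]; omega)
    (by omega)
  have hxX : x ∈ X := hPX (by simp)
  have hyX : y ∈ X := hPX (by simp)
  rw [hf.symmDiff_eq_of_card_inter hD hI hID (X := X) (by omega) (by omega) (by omega)]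
  refine hf.symmDiff_eq_of_card_inter hD cI ?_ (by omega) (by omega) ?_
  · rw [card_insert_erase_inter hx hy (by simp [hxD, hyD]), hID]
  · rw [card_insert_erase_inter hx hy (by simp [hxX, hyX])]
    omega

lemma IsAutPm.symmDiff_eq_of_sdiff_eq (hf : IsAutPm n m f) (hm : 2 ≤ m)
    (hcase : 3 * m + 1 ≤ n ∨ (n = 3 * m ∧ k = 1)) (hD : D.card = 2 * k)
    (hI : I.card = 2 * m) (hID : (I ∩ D).card = k) (hX : X.card = 2 * m)
    (h : I \ D = X \ D) : f I ∆ f (I ∆ D) = f X ∆ f (X ∆ D) := by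
  refine eq_of_swap_invariant (D : Set (Fin n)) (fun I => I.card = 2 * m ∧ (I ∩ D).card = k)
    (fun I => f I ∆ f (I ∆ D)) ?_ I X ⟨hI, hID⟩ (hI.trans hX.symm) ?_
  · rintro I x y ⟨hI, hID⟩ hx hy hxD hyD
    refine ⟨⟨?_, ?_⟩, hf.symmDiff_swap_of_mem hm hcase hD hI hID hx hy hxD hyD⟩
    · rw [Finset.card_insert_of_notMem (by simp [hy]), Finset.card_erase_of_mem hx, hI]
      omega
    · rw [card_insert_erase_inter hx hy (iff_of_true hxD hyD), hID]
  · intro x hx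
    have hz := Finset.ext_iff.1 h x
    rw [Finset.mem_coe] at hx
    simpa [hx] using hz

lemma IsAutPm.symmDiff_eq_of_inter_eq (hf : IsAutPm n m f) (hm : 2 ≤ m)
    (hcase : 3 * m + 1 ≤ n ∨ (n = 3 * m ∧ k = 1)) (hD : D.card = 2 * k)
    (hI : I.card = 2 * m) (hID : (I ∩ D).card = k) (hX : X.card = 2 * m)
    (h : I ∩ D = X ∩ D) : f I ∆ f (I ∆ D) = f X ∆ f (X ∆ D) := by
  refine eq_of_swap_invariant (D : Set (Fin n))ᶜ (fun I => I.card = 2 * m ∧ (I ∩ D).card = k)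
    (fun I => f I ∆ f (I ∆ D)) ?_ I X ⟨hI, hID⟩ (hI.trans hX.symm) ?_
  · rintro I x y ⟨hI, hID⟩ hx hy hxD hyD
    rw [Set.mem_compl_iff, Finset.mem_coe] at hxD hyD
    have cI : (insert y (I.erase x)).card = 2 * m := by
      rw [Finset.card_insert_of_notMem (by simp [hy]), Finset.card_erase_of_mem hx, hI]
      omega
    have cID : (insert y (I.erase x) ∩ D).card = k := by
      rw [card_insert_erase_inter hx hy (iff_of_false hxD hyD), hID]
    refine ⟨⟨cI, cID⟩, ?_⟩
    rcases Nat.lt_or_ge (2 * m) (k + 2) with hk | hk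
    · obtain ⟨h1, h2, h3⟩ := card_cells hD hI hID
      obtain ⟨-, h2', -⟩ := card_cells hD cI cID
      have hN : 0 < (I ∪ D)ᶜ.card := Finset.card_pos.2 ⟨y, by simp [hy, hyD]⟩
      have hC : 0 < (I \ D).card := Finset.card_pos.2 ⟨x, by simp [hx, hxD]⟩
      obtain ⟨B, hPB, hB, hBD, hIB⟩ := exists_superset_card_cells I D {y} m (m - 1) 0 1
        (by
          have : ({y} : Finset (Fin n)) ∩ (I ∩ D) = ∅ := by simp [hy]
          rw [this, Finset.card_empty]; omega)
        (by omega)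
        (by
          have : ({y} : Finset (Fin n)) ∩ (D \ I) = ∅ := by simp [hyD]
          rw [this, Finset.card_empty]; omega)
        (by omega)
        (by
          have : ({y} : Finset (Fin n)) ∩ (I \ D) = ∅ := by simp [hy]
          rw [this, Finset.card_empty])
        (by omega)
        ((Finset.card_le_card Finset.inter_subset_left).trans (by simp))
        (by omega)
      rw [hf.symmDiff_eq_of_card_inter hD hI hID (X := B) (by omega) (by omega) (by omega)]
      refine hf.symmDiff_eq_of_sdiff_eq hm hcase hD cI cID (by omega) ?_
      have hyB : y ∈ B := hPB (by simp)
      have hBD' := Finset.card_sdiff_add_card_inter B D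
      rw [← Finset.eq_of_subset_of_card_le (s := {y}) (t := B \ D) (by simp [hyB, hyD])
          (by rw [Finset.card_singleton]; omega),
        ← Finset.eq_of_subset_of_card_le (s := {y}) (t := insert y (I.erase x) \ D)
          (by simp [hyD]) (by rw [Finset.card_singleton]; omega)]
    · exact hf.symmDiff_swap_of_notMem hm (by omega) hk hD hI hID hx hy hxD hyD
  · intro x hx
    have hz := Finset.ext_iff.1 h x
    rw [Set.notMem_compl_iff, Finset.mem_coe] at hx
    simpa [hx] using hz

end Translation

/-- For `m ≥ 2` and an automorphism `f` of `P_m`: if `I, J, I', J'` are pairwise distinct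
`2m`-element subsets with `I ∆ J = I' ∆ J'`, and either `n ≥ 3m + 1`, or `n = 3m` and
`|I ∆ J| = 2`, then `f(I) ∆ f(J) = f(I') ∆ f(J')`. -/
theorem stmt_12 (n m : ℕ) (hm : 2 ≤ m) (hn : 3 * m ≤ n)
    (f : Finset (Fin n) → Finset (Fin n)) (hf : IsAutPm n m f)
    (I J I' J' : Finset (Fin n))
    (hI : I.card = 2 * m) (hJ : J.card = 2 * m)
    (hI' : I'.card = 2 * m) (hJ' : J'.card = 2 * m)
    (h1 : I ≠ J) (h2 : I ≠ I') (h3 : I ≠ J') (h4 : J ≠ I') (h5 : J ≠ J') (h6 : I' ≠ J')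
    (hsd : I ∆ J = I' ∆ J')
    (hcase : 3 * m + 1 ≤ n ∨ (n = 3 * m ∧ (I ∆ J).card = 2)) :
    f I ∆ f J = f I' ∆ f J' := by
  obtain ⟨D, hDdef⟩ : ∃ D, D = I ∆ J := ⟨_, rfl⟩
  have hJD : J = I ∆ D := by rw [hDdef, symmDiff_symmDiff_cancel_left]
  have hJD' : J' = I' ∆ D := by rw [hDdef, hsd, symmDiff_symmDiff_cancel_left]
  have c1 := Finset.card_symmDiff_add_two_mul_card_inter I D
  have c2 := Finset.card_symmDiff_add_two_mul_card_inter I' D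
  have c3 := Finset.card_symmDiff_add_two_mul_card_inter I J
  rw [← hJD] at c1
  rw [← hJD'] at c2
  rw [← hDdef] at c3 hcase
  obtain ⟨k, hk⟩ : ∃ k, (I ∩ D).card = k := ⟨_, rfl⟩
  have hD : D.card = 2 * k := by omega
  have hcase' : 3 * m + 1 ≤ n ∨ (n = 3 * m ∧ k = 1) := by omega
  have hdisj : Disjoint (I' ∩ D) (I \ D) :=
    Finset.disjoint_of_subset_left Finset.inter_subset_right Finset.disjoint_sdiff
  obtain ⟨M, hM⟩ : ∃ M, M = I' ∩ D ∪ I \ D := ⟨_, rfl⟩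
  have cM : M.card = 2 * m := by
    rw [hM, Finset.card_union_of_disjoint hdisj]
    have := Finset.card_sdiff_add_card_inter I D
    omega
  have hMD : M ∩ D = I' ∩ D := by
    ext z
    simp only [hM, Finset.mem_inter, Finset.mem_union, Finset.mem_sdiff]
    tauto
  have hMD' : I \ D = M \ D := by
    ext z
    simp only [hM, Finset.mem_inter, Finset.mem_union, Finset.mem_sdiff]
    tauto
  rw [hJD, hJD', hf.symmDiff_eq_of_sdiff_eq hm hcase' hD hI hk cM hMD']
  exact hf.symmDiff_eq_of_inter_eq hm hcase' hD cM (by rw [hMD]; omega) hI' hMD
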